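/- arXiv:1304.3710 — 3 statements merged into one kernel-verified Lean document; each statement's English description precedes it below -/
import Mathlib

section
/- For all ξ₁, η₁, ξ₂, η₂ ∈ C_c²((0,∞)), the following orthogonality relation holds: ∫₀^∞ ∫_ℝ (ξ₁ *₋ η₁)(b,a) · conj((ξ₂ *₋ η₂)(b,a)) db a⁻² da = (∫₀^∞ η₂(t) conj(η₁(t)) t⁻¹ dt) · (∫₀^∞ ξ₁(t) conj(ξ₂(t)) t⁻² dt). In particular both sides are well defined (the integrand on the left is integrable). -/
open MeasureTheory Set

/-- Coefficient function of the representation `π₊` of the real `ax+b` group: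
`(ξ *₊ η)(b,a) = ∫₀^∞ e^{-2πibt} ξ(at) conj(η(t)) t⁻¹ dt`. -/
noncomputable def coeffP (ξ η : ℝ → ℂ) (b a : ℝ) : ℂ :=
  ∫ t in Ioi (0 : ℝ),
    Complex.exp (-(2 * Real.pi * b * t : ℝ) * Complex.I) * ξ (a * t)
      * starRingEnd ℂ (η t) * (t : ℂ)⁻¹

/-- Coefficient function of the representation `π₋` of the real `ax+b` group:
`(ξ *₋ η)(b,a) = ∫₀^∞ e^{2πibt} ξ(at) conj(η(t)) t⁻¹ dt`. -/
noncomputable def coeffM (ξ η : ℝ → ℂ) (b a : ℝ) : ℂ :=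
  ∫ t in Ioi (0 : ℝ),
    Complex.exp ((2 * Real.pi * b * t : ℝ) * Complex.I) * ξ (a * t)
      * starRingEnd ℂ (η t) * (t : ℂ)⁻¹

/-- `C_c²((0,∞))`: twice continuously differentiable complex-valued functions on `ℝ`
with compact support contained in `(0,∞)`. -/
def CcTwo (f : ℝ → ℂ) : Prop :=
  ContDiff ℝ 2 f ∧ HasCompactSupport f ∧ tsupport f ⊆ Ioi (0 : ℝ)

/-- Left Haar measure `a⁻² db da` of the `ax+b` group, modelled on `ℝ × (0,∞)`
(first coordinate `b`, second coordinate `a`). -/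
noncomputable def muG : Measure (ℝ × ℝ) :=
  (((volume : Measure ℝ).prod ((volume : Measure ℝ).restrict (Ioi (0 : ℝ)))).withDensity
    fun p => ENNReal.ofReal ((p.2 ^ 2)⁻¹))

open FourierTransform

theorem ContDiff.sq_mul_norm_fourier_le {f : ℝ → ℂ} (hf : ContDiff ℝ 2 f)
    (hc : HasCompactSupport f) (x : ℝ) :
    x ^ 2 * ‖𝓕 f x‖ ≤ ∫ t, ‖iteratedDeriv 2 f t‖ := by
  have hint (n : ℕ) (hn : (n : ℕ∞) ≤ (2 : ℕ∞)) : Integrable (iteratedDeriv n f) := by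
    refine (hf.continuous_iteratedDeriv n (by exact_mod_cast hn)).integrable_of_hasCompactSupport ?_
    rw [iteratedDeriv_eq_equiv_comp]
    exact (hc.iteratedFDeriv n).comp_left (map_zero _)
  have h := congrFun (Real.fourier_iteratedDeriv (N := 2) (n := 2) hf hint le_rfl) x
  have hle := VectorFourier.norm_fourierIntegral_le_integral_norm Real.fourierChar volume
    (innerₗ ℝ) (iteratedDeriv 2 f) x
  change ‖𝓕 (iteratedDeriv 2 f) x‖ ≤ _ at hle
  rw [h] at hle
  refine le_trans ?_ hle
  simp only [smul_eq_mul, norm_mul, norm_pow, Complex.norm_I, Complex.norm_real,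
    Complex.norm_ofNat, Real.norm_eq_abs, mul_pow, sq_abs]
  have : (1 : ℝ) ≤ Real.pi ^ 2 := by nlinarith [Real.pi_gt_three]
  gcongr
  nlinarith [sq_nonneg x]

theorem ContDiff.integrable_fourier {f : ℝ → ℂ} (hf : ContDiff ℝ 2 f)
    (hc : HasCompactSupport f) : Integrable (𝓕 f) := by
  have hi : Integrable f := hf.continuous.integrable_of_hasCompactSupport hc
  have hcont : Continuous (𝓕 f) :=
    VectorFourier.fourierIntegral_continuous Real.continuous_fourierChar
      (by exact continuous_inner) hi
  refine (integrable_inv_one_add_sq.const_mul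
    ((∫ t, ‖f t‖) + ∫ t, ‖iteratedDeriv 2 f t‖)).mono' hcont.aestronglyMeasurable
    (.of_forall fun x ↦ ?_)
  rw [← div_eq_mul_inv, le_div_iff₀ (by positivity)]
  have h0 : ‖𝓕 f x‖ ≤ ∫ t, ‖f t‖ := VectorFourier.norm_fourierIntegral_le_integral_norm
    Real.fourierChar volume (innerₗ ℝ) f x
  linarith [hf.sq_mul_norm_fourier_le hc x]

theorem integral_fourier_mul_conj_fourier {f g : ℝ → ℂ} (hf : Continuous f) (hfi : Integrable f)
    (hFf : Integrable (𝓕 f)) (hgi : Integrable g) :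
    ∫ x, 𝓕 f x * starRingEnd ℂ (𝓕 g x) = ∫ t, f t * starRingEnd ℂ (g t) := by
  have h := VectorFourier.integral_sesq_fourierIntegral_eq_neg_flip (μ := (volume : Measure ℝ))
    (ν := (volume : Measure ℝ)) (L := innerₗ ℝ) (innerSL ℂ) Real.continuous_fourierChar
    (by exact continuous_inner) hgi hFf
  have hinv : VectorFourier.fourierIntegral Real.fourierChar volume (-(innerₗ ℝ).flip) (𝓕 f)
      = f := by
    rw [flip_innerₗ]
    exact hf.fourierInv_fourier_eq hfi hFf
  rw [hinv] at h
  exact h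

theorem CcTwo.integrable {f : ℝ → ℂ} (hf : CcTwo f) : Integrable f :=
  hf.1.continuous.integrable_of_hasCompactSupport hf.2.1

theorem CcTwo.mul {f g : ℝ → ℂ} (hf : CcTwo f) (hg : ContDiff ℝ 2 g) :
    CcTwo fun t ↦ f t * g t :=
  ⟨hf.1.mul hg, hf.2.1.mul_right, (tsupport_mul_subset_left (f := f) (g := g)).trans hf.2.2⟩

theorem CcTwo.conj {f : ℝ → ℂ} (hf : CcTwo f) : CcTwo fun t ↦ starRingEnd ℂ (f t) := by
  have hs : tsupport (fun t ↦ starRingEnd ℂ (f t)) ⊆ tsupport f :=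
    closure_mono (Function.support_comp_subset (map_zero _) f)
  exact ⟨Complex.conjCLE.contDiff.comp hf.1, hf.2.1.comp_left (map_zero (starRingEnd ℂ)),
    hs.trans hf.2.2⟩

theorem CcTwo.mul_inv {f : ℝ → ℂ} (hf : CcTwo f) : CcTwo fun t ↦ f t * (t : ℂ)⁻¹ := by
  have hs : tsupport (fun t ↦ f t * (t : ℂ)⁻¹) ⊆ tsupport f :=
    tsupport_mul_subset_left (f := f) (g := fun t : ℝ ↦ (t : ℂ)⁻¹)
  refine ⟨contDiff_iff_contDiffAt.2 fun x ↦ ?_, hf.2.1.mul_right, hs.trans hf.2.2⟩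
  by_cases hx : x ∈ tsupport (fun t ↦ f t * (t : ℂ)⁻¹)
  swap
  · exact contDiffAt_const.congr_of_eventuallyEq (notMem_tsupport_iff_eventuallyEq.1 hx)
  refine hf.1.contDiffAt.mul (Complex.ofRealCLM.contDiff.contDiffAt.inv ?_)
  simpa using (hf.2.2 (hs hx)).ne'

/-- The function whose inverse Fourier transform is `coeffM ξ η · a`. -/
noncomputable def coeffFiber (ξ η : ℝ → ℂ) (a t : ℝ) : ℂ :=
  ξ (a * t) * starRingEnd ℂ (η t) * (t : ℂ)⁻¹

theorem CcTwo.coeffFiber {ξ η : ℝ → ℂ} (hξ : CcTwo ξ) (hη : CcTwo η) (a : ℝ) :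
    CcTwo (coeffFiber ξ η a) := by
  have hc : ContDiff ℝ 2 fun t ↦ ξ (a * t) := hξ.1.comp (contDiff_const.mul contDiff_id)
  have h := hη.conj.mul_inv.mul hc
  convert h using 2 with t
  simp only [_root_.coeffFiber]
  ring

theorem coeffM_eq_fourier {η : ℝ → ℂ} (hη : CcTwo η) (ξ : ℝ → ℂ) (b a : ℝ) :
    coeffM ξ η b a = 𝓕 (coeffFiber ξ η a) (-b) := by
  rw [coeffM, setIntegral_eq_integral_of_forall_compl_eq_zero,
    Real.fourier_real_eq_integral_exp_smul]
  · refine integral_congr_ae (.of_forall fun t ↦ ?_)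
    simp only [coeffFiber, smul_eq_mul, ← mul_assoc]
    congr 5
    push_cast
    ring
  · intro t ht
    simp [image_eq_zero_of_notMem_tsupport fun h ↦ ht (hη.2.2 h)]

theorem integrable_coeffM {ξ₁ η₁ ξ₂ η₂ : ℝ → ℂ} (hξ₁ : CcTwo ξ₁) (hη₁ : CcTwo η₁)
    (hξ₂ : CcTwo ξ₂) (hη₂ : CcTwo η₂) (a : ℝ) :
    Integrable fun b ↦ coeffM ξ₁ η₁ b a * starRingEnd ℂ (coeffM ξ₂ η₂ b a) := by
  simp_rw [coeffM_eq_fourier hη₁, coeffM_eq_fourier hη₂]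
  have h₁ := hξ₁.coeffFiber hη₁ a
  have h₂ := hξ₂.coeffFiber hη₂ a
  have hi := (h₁.1.integrable_fourier h₁.2.1).mul_bdd
    (g := fun b ↦ starRingEnd ℂ (𝓕 (coeffFiber ξ₂ η₂ a) b)) (c := ∫ t, ‖coeffFiber ξ₂ η₂ a t‖)
    (Complex.continuous_conj.comp_aestronglyMeasurable
      (h₂.1.integrable_fourier h₂.2.1).aestronglyMeasurable)
    (.of_forall fun b ↦ by
      rw [RCLike.norm_conj]
      exact VectorFourier.norm_fourierIntegral_le_integral_norm
        Real.fourierChar volume (innerₗ ℝ) _ b)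
  exact hi.comp_neg

theorem integral_coeffM {ξ₁ η₁ ξ₂ η₂ : ℝ → ℂ} (hξ₁ : CcTwo ξ₁) (hη₁ : CcTwo η₁)
    (hξ₂ : CcTwo ξ₂) (hη₂ : CcTwo η₂) (a : ℝ) :
    ∫ b, coeffM ξ₁ η₁ b a * starRingEnd ℂ (coeffM ξ₂ η₂ b a)
      = ∫ t, coeffFiber ξ₁ η₁ a t * starRingEnd ℂ (coeffFiber ξ₂ η₂ a t) := by
  simp_rw [coeffM_eq_fourier hη₁, coeffM_eq_fourier hη₂]
  have h₁ := hξ₁.coeffFiber hη₁ a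
  rw [integral_neg_eq_self fun b ↦ 𝓕 (coeffFiber ξ₁ η₁ a) b *
    starRingEnd ℂ (𝓕 (coeffFiber ξ₂ η₂ a) b)]
  exact integral_fourier_mul_conj_fourier h₁.1.continuous h₁.integrable
    (h₁.1.integrable_fourier h₁.2.1) (hξ₂.coeffFiber hη₂ a).integrable

/-- The measure `a⁻² da` on `(0,∞)`. -/
noncomputable def invSqMeasure : Measure ℝ :=
  (volume.restrict (Ioi (0 : ℝ))).withDensity fun a ↦ ENNReal.ofReal ((a ^ 2)⁻¹)

instance : SFinite invSqMeasure := by unfold invSqMeasure; infer_instance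

theorem muG_eq_prod : muG = (volume : Measure ℝ).prod invSqMeasure := by
  rw [invSqMeasure, prod_withDensity_right (by fun_prop), muG]

theorem integrable_invSqMeasure_iff {E : Type*} [NormedAddCommGroup E] [NormedSpace ℝ E]
    {f : ℝ → E} :
    Integrable f invSqMeasure ↔ IntegrableOn (fun a ↦ (a ^ 2)⁻¹ • f a) (Ioi 0) := by
  rw [invSqMeasure, integrable_withDensity_iff_integrable_smul' (by fun_prop) (by simp),
    IntegrableOn]
  congr! with a
  exact ENNReal.toReal_ofReal (by positivity)

theorem integral_invSqMeasure {E : Type*} [NormedAddCommGroup E] [NormedSpace ℝ E] (f : ℝ → E) :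
    ∫ a, f a ∂invSqMeasure = ∫ a in Ioi (0 : ℝ), (a ^ 2)⁻¹ • f a := by
  rw [invSqMeasure, integral_withDensity_eq_integral_toReal_smul (by fun_prop) (by simp)]
  congr! with a
  exact ENNReal.toReal_ofReal (by positivity)

theorem CcTwo.integrable_invSqMeasure {f : ℝ → ℂ} (hf : CcTwo f) :
    Integrable f invSqMeasure := by
  rw [integrable_invSqMeasure_iff]
  refine (hf.mul_inv.mul_inv.integrable.congr (.of_forall fun a ↦ ?_)).integrableOn
  simp only [Complex.real_smul]
  push_cast
  ring

theorem integrable_comp_mul_invSqMeasure {E : Type*} [NormedAddCommGroup E] [NormedSpace ℝ E]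
    {f : ℝ → E} (hf : Integrable f invSqMeasure) {t : ℝ} (ht : 0 < t) :
    Integrable (fun a ↦ f (a * t)) invSqMeasure := by
  rw [integrable_invSqMeasure_iff] at hf ⊢
  have h := (integrableOn_Ioi_comp_mul_right_iff (fun a ↦ (a ^ 2)⁻¹ • f a) 0 ht).2
    (by simpa using hf)
  refine (h.smul (t ^ 2)).congr (.of_forall fun a ↦ ?_)
  simp only [Pi.smul_apply, smul_smul]
  congr 1
  field_simp

theorem integral_comp_mul_invSqMeasure {E : Type*} [NormedAddCommGroup E] [NormedSpace ℝ E]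
    (f : ℝ → E) {t : ℝ} (ht : 0 < t) :
    ∫ a, f (a * t) ∂invSqMeasure = t • ∫ a, f a ∂invSqMeasure := by
  have h := integral_comp_mul_right_Ioi (fun a ↦ (a ^ 2)⁻¹ • f a) 0 ht
  rw [integral_invSqMeasure, integral_invSqMeasure]
  rw [zero_mul] at h
  have h' : t • ∫ a in Ioi (0 : ℝ), (a ^ 2)⁻¹ • f a
      = t ^ 2 • ∫ a in Ioi (0 : ℝ), ((a * t) ^ 2)⁻¹ • f (a * t) := by
    rw [h, smul_smul]
    congr 1
    field_simp
  rw [h', ← integral_smul]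
  congr! 2 with a
  rw [smul_smul]
  congr 1
  field_simp

theorem CcTwo.eq_zero_of_nonpos {f : ℝ → ℂ} (hf : CcTwo f) {t : ℝ} (ht : t ≤ 0) : f t = 0 :=
  image_eq_zero_of_notMem_tsupport fun h ↦ ht.not_gt (hf.2.2 h)

theorem CcTwo.integrable_comp_mul_mul {f g : ℝ → ℂ} (hf : CcTwo f) (hg : CcTwo g) :
    Integrable (fun p : ℝ × ℝ ↦ f (p.1 * p.2) * g p.2) (invSqMeasure.prod volume) := by
  have hfc := hf.1.continuous
  have hgc := hg.1.continuous
  refine (integrable_prod_iff' (Continuous.aestronglyMeasurable (by fun_prop))).2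
    ⟨.of_forall fun t ↦ ?_, ?_⟩
  · rcases le_or_gt t 0 with ht | ht
    · simp [hg.eq_zero_of_nonpos ht]
    · have h := integrable_comp_mul_invSqMeasure hf.integrable_invSqMeasure ht
      exact h.mul_const (g t)
  · have h : (fun t ↦ ∫ a, ‖f (a * t) * g t‖ ∂invSqMeasure)
        = fun t ↦ ‖g t‖ * (t * ∫ a, ‖f a‖ ∂invSqMeasure) := by
      funext t
      rcases le_or_gt t 0 with ht | ht
      · simp [hg.eq_zero_of_nonpos ht]
      · simp_rw [norm_mul]
        rw [integral_mul_const, integral_comp_mul_invSqMeasure (fun a ↦ ‖f a‖) ht, smul_eq_mul,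
          mul_comm]
    rw [h]
    exact Continuous.integrable_of_hasCompactSupport (by fun_prop) hg.2.1.norm.mul_right

theorem CcTwo.integral_integral_comp_mul_mul {f g : ℝ → ℂ} (hf : CcTwo f) (hg : CcTwo g) :
    ∫ a, (∫ t, f (a * t) * g t) ∂invSqMeasure
      = (∫ t in Ioi (0 : ℝ), t * g t) * ∫ a, f a ∂invSqMeasure := by
  rw [integral_integral_swap (hf.integrable_comp_mul_mul hg),
    setIntegral_eq_integral_of_forall_compl_eq_zero
      (fun t ht ↦ by simp [hg.eq_zero_of_nonpos (not_lt.1 ht)]), ← integral_mul_const]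
  refine integral_congr_ae (.of_forall fun t ↦ ?_)
  simp only
  rcases le_or_gt t 0 with ht | ht
  · simp [hg.eq_zero_of_nonpos ht]
  · rw [integral_mul_const, integral_comp_mul_invSqMeasure f ht, Complex.real_smul]
    ring

theorem coeffFiber_mul_conj (ξ₁ η₁ ξ₂ η₂ : ℝ → ℂ) (a t : ℝ) :
    coeffFiber ξ₁ η₁ a t * starRingEnd ℂ (coeffFiber ξ₂ η₂ a t)
      = (ξ₁ (a * t) * starRingEnd ℂ (ξ₂ (a * t)))
        * (η₂ t * starRingEnd ℂ (η₁ t) * (t : ℂ)⁻¹ * (t : ℂ)⁻¹) := by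
  simp only [coeffFiber, map_mul, map_inv₀, Complex.conj_ofReal, Complex.conj_conj]
  ring

theorem integrable_integral_coeffM {ξ₁ η₁ ξ₂ η₂ : ℝ → ℂ} (hξ₁ : CcTwo ξ₁) (hη₁ : CcTwo η₁)
    (hξ₂ : CcTwo ξ₂) (hη₂ : CcTwo η₂) :
    Integrable (fun a ↦ ∫ b, coeffM ξ₁ η₁ b a * starRingEnd ℂ (coeffM ξ₂ η₂ b a))
      invSqMeasure := by
  simp_rw [integral_coeffM hξ₁ hη₁ hξ₂ hη₂, coeffFiber_mul_conj]
  exact ((hξ₁.mul hξ₂.conj.1).integrable_comp_mul_mul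
    (hη₂.mul hη₁.conj.1).mul_inv.mul_inv).integral_prod_left

theorem stronglyMeasurable_coeffM {ξ η : ℝ → ℂ} (hξ : Continuous ξ) (hη : Continuous η) :
    StronglyMeasurable fun p : ℝ × ℝ ↦ coeffM ξ η p.1 p.2 := by
  have h : Measurable fun q : (ℝ × ℝ) × ℝ ↦
      Complex.exp ((2 * Real.pi * q.1.1 * q.2 : ℝ) * Complex.I) * ξ (q.1.2 * q.2)
        * starRingEnd ℂ (η q.2) * (q.2 : ℂ)⁻¹ :=
    (Continuous.measurable (by fun_prop)).mul (by fun_prop)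
  exact h.stronglyMeasurable.integral_prod_right'

theorem integrable_coeffM_mul_conj {ξ₁ η₁ ξ₂ η₂ : ℝ → ℂ} (hξ₁ : CcTwo ξ₁) (hη₁ : CcTwo η₁)
    (hξ₂ : CcTwo ξ₂) (hη₂ : CcTwo η₂) :
    Integrable (fun p : ℝ × ℝ ↦
      coeffM ξ₁ η₁ p.1 p.2 * starRingEnd ℂ (coeffM ξ₂ η₂ p.1 p.2))
      ((volume : Measure ℝ).prod invSqMeasure) := by
  have hm : StronglyMeasurable (fun p : ℝ × ℝ ↦
      coeffM ξ₁ η₁ p.1 p.2 * starRingEnd ℂ (coeffM ξ₂ η₂ p.1 p.2)) :=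
    (stronglyMeasurable_coeffM hξ₁.1.continuous hη₁.1.continuous).mul
      (Complex.continuous_conj.comp_stronglyMeasurable
        (stronglyMeasurable_coeffM hξ₂.1.continuous hη₂.1.continuous))
  refine (integrable_prod_iff' hm.aestronglyMeasurable).2
    ⟨.of_forall fun a ↦ integrable_coeffM hξ₁ hη₁ hξ₂ hη₂ a, ?_⟩
  refine ((integrable_integral_coeffM hξ₁ hη₁ hξ₁ hη₁).norm.add
    (integrable_integral_coeffM hξ₂ hη₂ hξ₂ hη₂).norm).mono'
    hm.norm.integral_prod_left'.aestronglyMeasurable (.of_forall fun a ↦ ?_)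
  have h₁ := integrable_coeffM hξ₁ hη₁ hξ₁ hη₁ a
  have h₂ := integrable_coeffM hξ₂ hη₂ hξ₂ hη₂ a
  have hnn {ξ η : ℝ → ℂ} : ‖∫ b, coeffM ξ η b a * starRingEnd ℂ (coeffM ξ η b a)‖
      = ∫ b, ‖coeffM ξ η b a * starRingEnd ℂ (coeffM ξ η b a)‖ := by
    simp_rw [norm_mul, RCLike.norm_conj, Complex.mul_conj, Complex.normSq_eq_norm_sq, ← sq]
    rw [integral_complex_ofReal, Complex.norm_real,
      Real.norm_of_nonneg (integral_nonneg fun b ↦ sq_nonneg _)]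
  rw [Real.norm_of_nonneg (integral_nonneg fun b ↦ norm_nonneg _), Pi.add_apply, hnn, hnn,
    ← integral_add h₁.norm h₂.norm]
  refine integral_mono (integrable_coeffM hξ₁ hη₁ hξ₂ hη₂ a).norm (h₁.norm.add h₂.norm)
    fun b ↦ ?_
  simp only [norm_mul, RCLike.norm_conj]
  nlinarith [sq_nonneg (‖coeffM ξ₁ η₁ b a‖ - ‖coeffM ξ₂ η₂ b a‖),
    norm_nonneg (coeffM ξ₁ η₁ b a), norm_nonneg (coeffM ξ₂ η₂ b a)]

/-- **Orthogonality relations for `π₋`** (Proposition 4.5(b) of Choi–Ghandehari):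
for `ξᵢ, ηᵢ ∈ C_c²((0,∞))`,
`⟨ξ₁ *₋ η₁, ξ₂ *₋ η₂⟩_{L²(G)} = ⟨η₂, η₁⟩_ℋ ⟨K^{-1/2}ξ₁, K^{-1/2}ξ₂⟩_ℋ`. -/
theorem orthogonality_minus_minus (ξ₁ η₁ ξ₂ η₂ : ℝ → ℂ)
    (hξ₁ : CcTwo ξ₁) (hη₁ : CcTwo η₁) (hξ₂ : CcTwo ξ₂) (hη₂ : CcTwo η₂) :
    Integrable (fun p : ℝ × ℝ =>
      coeffM ξ₁ η₁ p.1 p.2 * starRingEnd ℂ (coeffM ξ₂ η₂ p.1 p.2)) muG ∧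
    ∫ p, coeffM ξ₁ η₁ p.1 p.2 * starRingEnd ℂ (coeffM ξ₂ η₂ p.1 p.2) ∂muG
      = (∫ t in Ioi (0 : ℝ), η₂ t * starRingEnd ℂ (η₁ t) * (t : ℂ)⁻¹) *
        (∫ t in Ioi (0 : ℝ), ξ₁ t * starRingEnd ℂ (ξ₂ t) * ((t : ℂ) ^ 2)⁻¹) := by
  have hi := integrable_coeffM_mul_conj hξ₁ hη₁ hξ₂ hη₂
  rw [muG_eq_prod]
  refine ⟨hi, ?_⟩
  rw [integral_prod_symm _ hi]
  simp_rw [integral_coeffM hξ₁ hη₁ hξ₂ hη₂, coeffFiber_mul_conj]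
  rw [(hξ₁.mul hξ₂.conj.1).integral_integral_comp_mul_mul
    (hη₂.mul hη₁.conj.1).mul_inv.mul_inv, integral_invSqMeasure]
  congr 1
  · refine setIntegral_congr_fun measurableSet_Ioi fun t ht ↦ ?_
    have : (t : ℂ) ≠ 0 := by exact_mod_cast (mem_Ioi.1 ht).ne'
    field_simp
  · congr! 2 with t
    rw [Complex.real_smul]
    push_cast
    ring
end

section
/- The linear span of the set of functions {ξ *₊ η : ξ, η ∈ C_c((0,∞))} ∪ {ξ *₋ η : ξ, η ∈ C_c((0,∞))} is dense in the Hilbert space L²(ℝ × (0,∞), a⁻² db da). -/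
open MeasureTheory Set

/-- `C_c((0,∞))`: continuous complex-valued functions on `ℝ` with compact support
contained in `(0,∞)`. -/
def CcZero (f : ℝ → ℂ) : Prop :=
  Continuous f ∧ HasCompactSupport f ∧ tsupport f ⊆ Ioi (0 : ℝ)

/-- A family of functions `D` separates `L²(μ)` if the only square-integrable function that
pairs to zero with every member of `D` is the zero function. -/
def SeparatesLTwo {α : Type*} [MeasurableSpace α] (μ : Measure α) (D : Set (α → ℂ)) : Prop :=
  ∀ F : α → ℂ, MemLp F 2 μ → (∀ g ∈ D, ∫ x, F x * g x ∂μ = 0) → F =ᵐ[μ] 0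

section Tensor

variable {X Y : Type*} [MeasurableSpace X] [MeasurableSpace Y] {μ : Measure X} {ν : Measure Y}

theorem memLp_two_iff_lintegral_lt_top {α : Type*} [MeasurableSpace α] {μ : Measure α}
    {f : α → ℂ} (hf : AEStronglyMeasurable f μ) :
    MemLp f 2 μ ↔ ∫⁻ x, ‖f x‖ₑ ^ 2 ∂μ < ⊤ := by
  rw [memLp_two_iff_integrable_sq_norm hf, Integrable, hasFiniteIntegral_iff_enorm,
    and_iff_right (by fun_prop)]
  simp

theorem MeasureTheory.MemLp.tensor [SFinite ν] {f : X → ℂ} {g : Y → ℂ} (hf : MemLp f 2 μ)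
    (hg : MemLp g 2 ν) :
    MemLp (fun p : X × Y => f p.1 * g p.2) 2 (μ.prod ν) := by
  have hm : AEStronglyMeasurable (fun p : X × Y => f p.1 * g p.2) (μ.prod ν) :=
    hf.1.comp_fst.mul hg.1.comp_snd
  rw [memLp_two_iff_integrable_sq_norm hm]
  have := ((memLp_two_iff_integrable_sq_norm hf.1).1 hf).mul_prod
    ((memLp_two_iff_integrable_sq_norm hg.1).1 hg)
  simpa [mul_pow] using this

theorem MeasureTheory.MemLp.integrable_mul_two {α : Type*} [MeasurableSpace α] {μ : Measure α}
    {f g : α → ℂ} (hf : MemLp f 2 μ) (hg : MemLp g 2 μ) :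
    Integrable (fun x => f x * g x) μ :=
  MemLp.integrable_mul hf hg

theorem enorm_integral_mul_sq_le {α : Type*} [MeasurableSpace α] {μ : Measure α}
    {f g : α → ℂ} (hf : AEStronglyMeasurable f μ) (hg : AEStronglyMeasurable g μ) :
    ‖∫ x, f x * g x ∂μ‖ₑ ^ 2 ≤ (∫⁻ x, ‖f x‖ₑ ^ 2 ∂μ) * ∫⁻ x, ‖g x‖ₑ ^ 2 ∂μ := by
  have h := (enorm_integral_le_lintegral_enorm (μ := μ) fun x => f x * g x).trans
    ((lintegral_congr fun x => enorm_mul _ _).le.trans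
      (ENNReal.lintegral_mul_le_Lp_mul_Lq μ Real.HolderConjugate.two_two hf.enorm hg.enorm))
  refine (pow_le_pow_left' h 2).trans (le_of_eq ?_)
  rw [mul_pow, ← ENNReal.rpow_natCast, ← ENNReal.rpow_natCast, ← ENNReal.rpow_mul,
    ← ENNReal.rpow_mul]
  simp

theorem MeasureTheory.MemLp.integral_mul_right [SFinite ν] {F : X × Y → ℂ} {g : Y → ℂ}
    (hF : MemLp F 2 (μ.prod ν)) (hg : MemLp g 2 ν) :
    MemLp (fun x => ∫ y, F (x, y) * g y ∂ν) 2 μ := by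
  have hm : AEStronglyMeasurable (fun p : X × Y => F p * g p.2) (μ.prod ν) :=
    hF.1.mul hg.1.comp_snd
  have hF' := (memLp_two_iff_lintegral_lt_top hF.1).1 hF
  have hg' := (memLp_two_iff_lintegral_lt_top hg.1).1 hg
  rw [memLp_two_iff_lintegral_lt_top hm.integral_prod_right']
  calc ∫⁻ x, ‖∫ y, F (x, y) * g y ∂ν‖ₑ ^ 2 ∂μ
      ≤ ∫⁻ x, (∫⁻ y, ‖F (x, y)‖ₑ ^ 2 ∂ν) * ∫⁻ y, ‖g y‖ₑ ^ 2 ∂ν ∂μ := by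
        refine lintegral_mono_ae ?_
        filter_upwards [hF.1.prodMk_left] with x hx
        exact enorm_integral_mul_sq_le hx hg.1
    _ = (∫⁻ x, ∫⁻ y, ‖F (x, y)‖ₑ ^ 2 ∂ν ∂μ) * ∫⁻ y, ‖g y‖ₑ ^ 2 ∂ν :=
        lintegral_mul_const' _ _ hg'.ne
    _ < ⊤ := by
        rw [lintegral_prod _ (hF.1.enorm.pow_const 2)] at hF'
        exact ENNReal.mul_lt_top hF' hg'

theorem ae_eq_zero_of_setIntegral_prod_eq_zero [SFinite ν] {G : X × Y → ℂ}
    (hG : Integrable G (μ.prod ν))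
    (h : ∀ A B, MeasurableSet A → MeasurableSet B → ∫ p in A ×ˢ B, G p ∂μ.prod ν = 0) :
    G =ᵐ[μ.prod ν] 0 := by
  refine hG.ae_eq_zero_of_forall_setIntegral_eq_zero fun s hs hs' => ?_
  clear hs'
  induction s, hs using MeasurableSpace.induction_on_inter generateFrom_prod.symm
    isPiSystem_prod with
  | empty => simp
  | basic t ht =>
    obtain ⟨A, hA, B, hB, rfl⟩ := ht
    exact h A B hA hB
  | compl t ht ih =>
    have huniv : ∫ p, G p ∂μ.prod ν = 0 := by
      simpa using h univ univ MeasurableSet.univ MeasurableSet.univ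
    have := integral_add_compl ht hG
    rwa [ih, huniv, zero_add] at this
  | iUnion f hd hm ih =>
    rw [integral_iUnion hm hd hG.integrableOn]
    simp [ih]

theorem SeparatesLTwo.tensor [SigmaFinite μ] [SigmaFinite ν] {D₁ : Set (X → ℂ)} {D₂ : Set (Y → ℂ)}
    (h₁ : SeparatesLTwo μ D₁) (h₂ : SeparatesLTwo ν D₂)
    (hD₁ : ∀ f ∈ D₁, MemLp f 2 μ) (hD₂ : ∀ g ∈ D₂, MemLp g 2 ν) :
    SeparatesLTwo (μ.prod ν) {k | ∃ f ∈ D₁, ∃ g ∈ D₂, k = fun p => f p.1 * g p.2} := by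
  intro F hF h
  have hrect : ∀ A B, MeasurableSet A → MeasurableSet B → μ A < ⊤ → ν B < ⊤ →
      ∫ p in A ×ˢ B, F p ∂μ.prod ν = 0 := by
    intro A B hA hB hμA hνB
    have hAm : MemLp (A.indicator fun _ => (1 : ℂ)) 2 μ :=
      memLp_indicator_const 2 hA 1 (Or.inr hμA.ne)
    have hBm : MemLp (B.indicator fun _ => (1 : ℂ)) 2 ν :=
      memLp_indicator_const 2 hB 1 (Or.inr hνB.ne)
    have hslice : ∀ g ∈ D₂, (fun x => ∫ y, F (x, y) * g y ∂ν) =ᵐ[μ] 0 := by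
      intro g hg
      refine h₁ _ (hF.integral_mul_right (hD₂ g hg)) fun f hf => ?_
      rw [← h _ ⟨f, hf, g, hg, rfl⟩,
        integral_prod _ (hF.integrable_mul_two ((hD₁ f hf).tensor (hD₂ g hg)))]
      refine integral_congr_ae (ae_of_all _ fun x => ?_)
      simp only [← integral_mul_const]
      exact integral_congr_ae (ae_of_all _ fun y => by ring)
    have hsw : MemLp (fun q : Y × X => F q.swap) 2 (ν.prod μ) :=
      hF.comp_measurePreserving Measure.measurePreserving_swap
    have hA0 : (fun y => ∫ x, F (x, y) * A.indicator (fun _ => (1 : ℂ)) x ∂μ) =ᵐ[ν] 0 := by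
      refine h₂ _ (hsw.integral_mul_right hAm) fun g hg => ?_
      calc ∫ y, (∫ x, F (x, y) * A.indicator (fun _ => (1 : ℂ)) x ∂μ) * g y ∂ν
          = ∫ y, ∫ x, F (x, y) * (A.indicator (fun _ => (1 : ℂ)) x * g y) ∂μ ∂ν := by
            simp only [← integral_mul_const, mul_assoc]
        _ = ∫ x, ∫ y, F (x, y) * (A.indicator (fun _ => (1 : ℂ)) x * g y) ∂ν ∂μ :=
            (integral_integral_swap (hF.integrable_mul_two (hAm.tensor (hD₂ g hg)))).symm
        _ = ∫ x, (∫ y, F (x, y) * g y ∂ν) * A.indicator (fun _ => (1 : ℂ)) x ∂μ := by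
            simp only [← integral_mul_const]
            congr! 4 with x y
            ring
        _ = 0 := by
            refine integral_eq_zero_of_ae ?_
            filter_upwards [hslice g hg] with x hx
            simp only [hx, Pi.zero_apply, zero_mul]
    calc ∫ p in A ×ˢ B, F p ∂μ.prod ν
        = ∫ p, F p * (A.indicator (fun _ => (1 : ℂ)) p.1 * B.indicator (fun _ => (1 : ℂ)) p.2)
            ∂μ.prod ν := by
          rw [← integral_indicator (hA.prod hB)]
          congr! 2 with p
          by_cases h1 : p.1 ∈ A <;> by_cases h2 : p.2 ∈ B <;> simp [h1, h2, indicator, mem_prod]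
      _ = ∫ y, (∫ x, F (x, y) * A.indicator (fun _ => (1 : ℂ)) x ∂μ) *
            B.indicator (fun _ => (1 : ℂ)) y ∂ν := by
          rw [integral_prod_symm _ (hF.integrable_mul_two (hAm.tensor hBm))]
          simp only [← integral_mul_const, mul_assoc]
      _ = 0 := by
          refine integral_eq_zero_of_ae ?_
          filter_upwards [hA0] with y hy
          simp only [hy, Pi.zero_apply, zero_mul]
  have hpiece : ∀ m n : ℕ, ∀ᵐ p ∂(μ.prod ν).restrict (spanningSets μ m ×ˢ spanningSets ν n),
      F p = 0 := by
    intro m n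
    have hfin : Fact (μ (spanningSets μ m) < ⊤) := ⟨measure_spanningSets_lt_top μ m⟩
    have hfin' : Fact (ν (spanningSets ν n) < ⊤) := ⟨measure_spanningSets_lt_top ν n⟩
    have hint : Integrable F ((μ.restrict (spanningSets μ m)).prod
        (ν.restrict (spanningSets ν n))) := by
      have h2 := hF.restrict (spanningSets μ m ×ˢ spanningSets ν n)
      rw [← Measure.prod_restrict] at h2
      exact h2.integrable one_le_two
    rw [← Measure.prod_restrict]
    refine ae_eq_zero_of_setIntegral_prod_eq_zero hint fun A B hA hB => ?_
    rw [Measure.prod_restrict, Measure.restrict_restrict (hA.prod hB), prod_inter_prod]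
    exact hrect _ _ (hA.inter (measurableSet_spanningSets μ m))
      (hB.inter (measurableSet_spanningSets ν n))
      ((measure_mono inter_subset_right).trans_lt hfin.out)
      ((measure_mono inter_subset_right).trans_lt hfin'.out)
  have hcover : ⋃ i : ℕ × ℕ, spanningSets μ i.1 ×ˢ spanningSets ν i.2 = univ := by
    rw [iUnion_prod, iUnion_spanningSets, iUnion_spanningSets, univ_prod_univ]
  have := (ae_restrict_iUnion_iff (μ := μ.prod ν)
    (fun i : ℕ × ℕ => spanningSets μ i.1 ×ˢ spanningSets ν i.2) (fun p => F p = 0)).2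
      fun i => hpiece i.1 i.2
  rwa [hcover, Measure.restrict_univ] at this

end Tensor

open scoped ContDiff FourierTransform SchwartzMap

/-- Smooth complex-valued functions on `ℝ` with compact support contained in `s`. -/
def smoothCompactlySupportedIn (s : Set ℝ) : Set (ℝ → ℂ) :=
  {f | ContDiff ℝ ∞ f ∧ HasCompactSupport f ∧ tsupport f ⊆ s}

theorem eq_zero_of_mem_smoothCompactlySupportedIn {s : Set ℝ} {f : ℝ → ℂ}
    (hf : f ∈ smoothCompactlySupportedIn s) {x : ℝ} (hx : x ∉ s) : f x = 0 :=
  image_eq_zero_of_notMem_tsupport fun h => hx (hf.2.2 h)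

theorem ofReal_comp_mem_smoothCompactlySupportedIn {s : Set ℝ} {g : ℝ → ℝ} (hg : ContDiff ℝ ∞ g)
    (hc : HasCompactSupport g) (hs : tsupport g ⊆ s) :
    (fun x => (g x : ℂ)) ∈ smoothCompactlySupportedIn s :=
  ⟨Complex.ofRealCLM.contDiff.comp hg, hc.comp_left (g := fun x : ℝ => (x : ℂ)) Complex.ofReal_zero,
    (closure_mono (Function.support_comp_subset Complex.ofReal_zero g)).trans hs⟩

/-- The measure `w(a) da` on `(0,∞)`. -/
noncomputable def weightedIoi (w : ℝ → ℝ) : Measure ℝ :=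
  (volume.restrict (Ioi (0 : ℝ))).withDensity fun a => ENNReal.ofReal (w a)

instance (w : ℝ → ℝ) : SigmaFinite (weightedIoi w) := SigmaFinite.withDensity_ofReal _

theorem ae_weightedIoi_pos (w : ℝ → ℝ) : ∀ᵐ a ∂weightedIoi w, 0 < a :=
  (withDensity_absolutelyContinuous _ _).ae_le (ae_restrict_mem measurableSet_Ioi)

section Weighted

variable {w : ℝ → ℝ}

theorem weightedIoi_lt_top_of_isCompact (hw : ContinuousOn w (Ioi 0)) {K : Set ℝ}
    (hK : IsCompact K) (hK0 : K ⊆ Ioi 0) : weightedIoi w K < ⊤ := by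
  rw [weightedIoi, withDensity_apply _ hK.measurableSet,
    Measure.restrict_restrict hK.measurableSet, inter_eq_left.2 hK0]
  exact ((hw.mono hK0).integrableOn_compact hK).lintegral_lt_top

theorem memLp_weightedIoi (hw : ContinuousOn w (Ioi 0)) {f : ℝ → ℂ}
    (hf : f ∈ smoothCompactlySupportedIn (Ioi 0)) : MemLp f 2 (weightedIoi w) := by
  obtain ⟨hd, hc, hs⟩ := hf
  have hfin : Fact (weightedIoi w (tsupport f) < ⊤) :=
    ⟨weightedIoi_lt_top_of_isCompact hw hc hs⟩
  rw [← indicator_eq_self.2 (subset_tsupport f),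
    memLp_indicator_iff_restrict (isClosed_tsupport f).measurableSet]
  obtain ⟨C, hC⟩ := hc.exists_bound_of_continuous hd.continuous
  exact MemLp.of_bound hd.continuous.aestronglyMeasurable C (ae_of_all _ hC)

theorem separatesLTwo_weightedIoi (hm : Measurable w) (hw : ContinuousOn w (Ioi 0))
    (hpos : ∀ x, 0 < x → 0 < w x) :
    SeparatesLTwo (weightedIoi w) (smoothCompactlySupportedIn (Ioi 0)) := by
  intro F hF h
  have hloc : LocallyIntegrableOn (fun x => w x • F x) (Ioi 0) := by
    rw [locallyIntegrableOn_iff isOpen_Ioi.isLocallyClosed]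
    intro K hK0 hK
    have hfin : Fact (weightedIoi w K < ⊤) := ⟨weightedIoi_lt_top_of_isCompact hw hK hK0⟩
    have hint : IntegrableOn F K (weightedIoi w) := (hF.restrict K).integrable one_le_two
    rw [IntegrableOn, weightedIoi, restrict_withDensity hK.measurableSet,
      Measure.restrict_restrict hK.measurableSet, inter_eq_left.2 hK0,
      integrable_withDensity_iff_integrable_smul' (by fun_prop) (by simp)] at hint
    refine hint.congr ?_
    filter_upwards [ae_restrict_mem hK.measurableSet] with x hx
    rw [ENNReal.toReal_ofReal (hpos x (hK0 hx)).le]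
  have hzero := isOpen_Ioi.ae_eq_zero_of_integral_contDiff_smul_eq_zero hloc fun g hg hgc hgs => by
    rw [← h _ (ofReal_comp_mem_smoothCompactlySupportedIn hg hgc hgs), weightedIoi,
      integral_withDensity_eq_integral_toReal_smul (by fun_prop) (by simp),
      ← setIntegral_eq_integral_of_forall_compl_eq_zero (s := Ioi (0 : ℝ))]
    · refine setIntegral_congr_fun measurableSet_Ioi fun x hx => ?_
      simp only [ENNReal.toReal_ofReal (hpos x hx).le, Complex.real_smul]
      ring
    · intro x hx
      rw [image_eq_zero_of_notMem_tsupport fun h' => hx (hgs h'), zero_smul]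
  refine (withDensity_absolutelyContinuous _ _).ae_le ?_
  filter_upwards [ae_restrict_of_ae hzero, ae_restrict_mem measurableSet_Ioi] with x hx hx0
  exact (smul_eq_zero.1 (hx hx0)).resolve_left (hpos x hx0).ne'

end Weighted

theorem integral_fourier_mul_toLp (F : Lp ℂ 2 (volume : Measure ℝ)) (φ : 𝓢(ℝ, ℂ)) :
    ∫ x, φ x * (𝓕 F : Lp ℂ 2 (volume : Measure ℝ)) x = ∫ x, F x * 𝓕 (φ : ℝ → ℂ) x := by
  have h := DFunLike.congr_fun (Lp.fourier_toTemperedDistribution_eq F) φ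
  rw [TemperedDistribution.fourier_apply, Lp.toTemperedDistribution_apply,
    Lp.toTemperedDistribution_apply] at h
  simp only [smul_eq_mul, SchwartzMap.fourier_coe] at h
  rw [← h]
  simp only [mul_comm]

/-- Fourier transforms of test functions supported away from the origin. -/
def fourierTestFunctions : Set (ℝ → ℂ) :=
  {f | ∃ φ ∈ smoothCompactlySupportedIn (Ioi 0) ∪ smoothCompactlySupportedIn (Iio 0), f = 𝓕 φ}

theorem memLp_fourier {s : Set ℝ} {φ : ℝ → ℂ} (hφ : φ ∈ smoothCompactlySupportedIn s) :
    MemLp (𝓕 φ) 2 (volume : Measure ℝ) :=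
  (𝓕 (hφ.2.1.toSchwartzMap hφ.1)).memLp 2 volume

theorem separatesLTwo_fourierTestFunctions :
    SeparatesLTwo (volume : Measure ℝ) fourierTestFunctions := by
  intro F hF h
  set G : Lp ℂ 2 (volume : Measure ℝ) := 𝓕 (hF.toLp F) with hG
  have hloc : LocallyIntegrable G := (Lp.memLp G).locallyIntegrable one_le_two
  have key : ∀ s, smoothCompactlySupportedIn s ⊆
      smoothCompactlySupportedIn (Ioi 0) ∪ smoothCompactlySupportedIn (Iio 0) → IsOpen s →
      ∀ᵐ x, x ∈ s → G x = 0 := by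
    intro s hs ho
    refine ho.ae_eq_zero_of_integral_contDiff_smul_eq_zero (hloc.locallyIntegrableOn s)
      fun g hg hgc hgs => ?_
    have hmem := ofReal_comp_mem_smoothCompactlySupportedIn hg hgc hgs
    calc ∫ x, g x • G x = ∫ x, hmem.2.1.toSchwartzMap hmem.1 x * G x := rfl
      _ = ∫ x, hF.toLp F x * 𝓕 (fun x => (g x : ℂ)) x := integral_fourier_mul_toLp _ _
      _ = ∫ x, F x * 𝓕 (fun x => (g x : ℂ)) x := by
        refine integral_congr_ae ?_
        filter_upwards [hF.coeFn_toLp] with x hx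
        rw [hx]
      _ = 0 := h _ ⟨_, hs hmem, rfl⟩
  have hG0 : G = 0 := by
    rw [Lp.eq_zero_iff_ae_eq_zero]
    filter_upwards [key _ subset_union_left isOpen_Ioi, key _ subset_union_right isOpen_Iio,
      Measure.ae_ne volume (0 : ℝ)] with x h1 h2 hx
    exact hx.lt_or_gt.elim h2 h1
  rw [hG, ← norm_eq_zero, Lp.norm_fourier_eq, norm_eq_zero, Lp.eq_zero_iff_ae_eq_zero] at hG0
  exact hF.coeFn_toLp.symm.trans hG0

theorem muG_eq_prod_s10 : muG = (volume : Measure ℝ).prod (weightedIoi fun a => (a ^ 2)⁻¹) := by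
  rw [muG, weightedIoi, prod_withDensity_right (by fun_prop)]

theorem SchwartzMap.lintegral_enorm_fourier_sq (φ : 𝓢(ℝ, ℂ)) :
    ∫⁻ x, ‖𝓕 (φ : ℝ → ℂ) x‖ₑ ^ 2 = ∫⁻ x, ‖φ x‖ₑ ^ 2 := by
  have key : ∀ ψ : 𝓢(ℝ, ℂ), ∫⁻ x, ‖ψ x‖ₑ ^ 2 = ENNReal.ofReal (∫ x, ‖ψ x‖ ^ 2) := fun ψ => by
    rw [ofReal_integral_eq_lintegral_ofReal
      ((memLp_two_iff_integrable_sq_norm ψ.continuous.aestronglyMeasurable).1 (ψ.memLp 2 volume))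
      (ae_of_all _ fun x => by positivity)]
    simp [ENNReal.ofReal_pow]
  rw [key, ← SchwartzMap.integral_norm_sq_fourier, ← key]
  rfl

theorem lintegral_weightedIoi_comp_mul_left {t : ℝ} (ht : 0 < t) {f : ℝ → ENNReal}
    (hf : Measurable f) :
    ∫⁻ a, f (a * t) ∂weightedIoi (fun a => (a ^ 2)⁻¹) =
      ENNReal.ofReal t * ∫⁻ s, f s ∂weightedIoi (fun a => (a ^ 2)⁻¹) := by
  have hw : Measurable fun a : ℝ => ENNReal.ofReal ((a ^ 2)⁻¹) := by fun_prop
  have hft : Measurable fun a => f (a * t) := by fun_prop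
  rw [weightedIoi, lintegral_withDensity_eq_lintegral_mul _ hw hft,
    lintegral_withDensity_eq_lintegral_mul _ hw hf, ← lintegral_indicator measurableSet_Ioi,
    ← lintegral_indicator measurableSet_Ioi]
  have hmeas : Measurable
      ((Ioi (0 : ℝ)).indicator ((fun a : ℝ => ENNReal.ofReal ((a ^ 2)⁻¹)) * f)) :=
    (hw.mul hf).indicator measurableSet_Ioi
  conv_rhs => rw [← Real.smul_map_volume_mul_right ht.ne']
  rw [lintegral_smul_measure, lintegral_map hmeas (by fun_prop), smul_eq_mul, ← mul_assoc,
    ← lintegral_const_mul _ (by fun_prop)]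
  refine lintegral_congr fun a => ?_
  by_cases ha : 0 < a
  · have hat : 0 < a * t := mul_pos ha ht
    rw [indicator_of_mem (show a ∈ Ioi 0 from ha), indicator_of_mem (show a * t ∈ Ioi 0 from hat),
      Pi.mul_apply, Pi.mul_apply, ← mul_assoc, abs_of_pos ht, ← ENNReal.ofReal_mul ht.le,
      ← ENNReal.ofReal_mul (by positivity)]
    congr 2
    field_simp
  · have hat : ¬ 0 < a * t := fun h => ha ((mul_pos_iff_of_pos_right ht).1 h)
    rw [indicator_of_notMem (show a ∉ Ioi 0 from ha),
      indicator_of_notMem (show a * t ∉ Ioi 0 from hat), mul_zero]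

/-- The function `(b, a) ↦ ∫ e^{-2πibt} L(t, at) dt`. -/
noncomputable def dilationFourier (L : ℝ × ℝ → ℂ) (p : ℝ × ℝ) : ℂ :=
  𝓕 (fun t => L (t, p.2 * t)) p.1

/-- The measure `t s⁻² dt ds` on `(0,∞) × (0,∞)`, for which `dilationFourier` is isometric. -/
noncomputable def dilationMeasure : Measure (ℝ × ℝ) :=
  (weightedIoi fun t => t).prod (weightedIoi fun s => (s ^ 2)⁻¹)

/-- Square-integrable functions on `(0,∞) × (0,∞)` which are Schwartz functions along every
ray from the origin. -/
def raySchwartz : Submodule ℂ (ℝ × ℝ → ℂ) where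
  carrier := {L | Measurable L ∧ (∀ t ≤ 0, ∀ s, L (t, s) = 0) ∧
    (∀ a > 0, ∃ φ : 𝓢(ℝ, ℂ), ⇑φ = fun t => L (t, a * t)) ∧ MemLp L 2 dilationMeasure}
  add_mem' := by
    rintro L M ⟨h1, h2, h3, h4⟩ ⟨k1, k2, k3, k4⟩
    refine ⟨h1.add k1, fun t ht s => by simp [h2 t ht, k2 t ht], fun a ha => ?_, h4.add k4⟩
    obtain ⟨φ, hφ⟩ := h3 a ha
    obtain ⟨ψ, hψ⟩ := k3 a ha
    exact ⟨φ + ψ, by ext t; simp [hφ, hψ]⟩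
  zero_mem' := ⟨measurable_zero, fun _ _ _ => rfl, fun _ _ => ⟨0, rfl⟩, MemLp.zero⟩
  smul_mem' := by
    rintro c L ⟨h1, h2, h3, h4⟩
    refine ⟨h1.const_smul c, fun t ht s => by simp [h2 t ht], fun a ha => ?_, h4.const_smul c⟩
    obtain ⟨φ, hφ⟩ := h3 a ha
    exact ⟨c • φ, by ext t; simp [hφ]⟩

theorem stronglyMeasurable_dilationFourier {L : ℝ × ℝ → ℂ} (hL : Measurable L) :
    StronglyMeasurable (dilationFourier L) := by
  have h : StronglyMeasurable fun q : (ℝ × ℝ) × ℝ =>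
      Complex.exp (↑(-2 * Real.pi * q.2 * q.1.1) * Complex.I) • L (q.2, q.1.2 * q.2) :=
    (by fun_prop : Measurable _).stronglyMeasurable
  have h' := h.integral_prod_right' (ν := volume)
  convert h' using 1
  ext p
  rw [dilationFourier, Real.fourier_real_eq_integral_exp_smul]

theorem lintegral_dilationFourier {L : ℝ × ℝ → ℂ} (hL : Measurable L)
    (h0 : ∀ t ≤ 0, ∀ s, L (t, s) = 0)
    (hS : ∀ a > 0, ∃ φ : 𝓢(ℝ, ℂ), ⇑φ = fun t => L (t, a * t)) :
    ∫⁻ p, ‖dilationFourier L p‖ₑ ^ 2 ∂muG = ∫⁻ q, ‖L q‖ₑ ^ 2 ∂dilationMeasure := by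
  have hL2 : Measurable fun q => ‖L q‖ₑ ^ 2 := by fun_prop
  have hJ : Measurable fun p => ‖dilationFourier L p‖ₑ ^ 2 :=
    (stronglyMeasurable_dilationFourier hL).measurable.enorm.pow_const 2
  set ν := weightedIoi fun s => (s ^ 2)⁻¹ with hν
  calc ∫⁻ p, ‖dilationFourier L p‖ₑ ^ 2 ∂muG
      = ∫⁻ a, (∫⁻ b, ‖dilationFourier L (b, a)‖ₑ ^ 2) ∂ν := by
        rw [muG_eq_prod_s10, lintegral_prod_symm _ hJ.aemeasurable]
    _ = ∫⁻ a, (∫⁻ t, ‖L (t, a * t)‖ₑ ^ 2) ∂ν := by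
        refine lintegral_congr_ae ?_
        filter_upwards [ae_weightedIoi_pos _] with a ha
        obtain ⟨φ, hφ⟩ := hS a ha
        have := φ.lintegral_enorm_fourier_sq
        rwa [hφ] at this
    _ = ∫⁻ t, ∫⁻ a, ‖L (t, a * t)‖ₑ ^ 2 ∂ν :=
        lintegral_lintegral_swap (hL2.comp (by fun_prop :
          Measurable fun q : ℝ × ℝ => (q.2, q.1 * q.2))).aemeasurable
    _ = ∫⁻ t in Ioi 0, ∫⁻ a, ‖L (t, a * t)‖ₑ ^ 2 ∂ν := by
        rw [← lintegral_indicator measurableSet_Ioi]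
        refine lintegral_congr fun t => ?_
        by_cases ht : 0 < t
        · rw [indicator_of_mem (show t ∈ Ioi 0 from ht)]
        · simp [indicator_of_notMem (show t ∉ Ioi 0 from ht), h0 t (not_lt.1 ht)]
    _ = ∫⁻ t in Ioi 0, ENNReal.ofReal t * ∫⁻ s, ‖L (t, s)‖ₑ ^ 2 ∂ν := by
        refine setLIntegral_congr_fun measurableSet_Ioi fun t ht => ?_
        exact lintegral_weightedIoi_comp_mul_left (f := fun s => ‖L (t, s)‖ₑ ^ 2) ht
          (by fun_prop)
    _ = ∫⁻ q, ‖L q‖ₑ ^ 2 ∂dilationMeasure := by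
        rw [dilationMeasure, lintegral_prod _ hL2.aemeasurable, weightedIoi,
          lintegral_withDensity_eq_lintegral_mul _ (by fun_prop) hL2.lintegral_prod_right']
        rfl

theorem dense_span_of_forall_integral_mul_eq_zero {α : Type*} [MeasurableSpace α] {μ : Measure α}
    {S : Set (Lp ℂ 2 μ)}
    (h : ∀ F : α → ℂ, MemLp F 2 μ → (∀ G ∈ S, ∫ x, F x * G x ∂μ = 0) → F =ᵐ[μ] 0) :
    Dense (Submodule.span ℂ S : Set (Lp ℂ 2 μ)) := by
  rw [Submodule.dense_iff_topologicalClosure_eq_top, Submodule.topologicalClosure_eq_top_iff,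
    Submodule.eq_bot_iff]
  intro H hH
  rw [Lp.eq_zero_iff_ae_eq_zero]
  have := h (fun x => starRingEnd ℂ (H x)) (Lp.memLp H).star fun G hG => by
    rw [← inner_eq_zero_symm.1 ((Submodule.mem_orthogonal _ _).1 hH G (Submodule.subset_span hG)),
      L2.inner_def]
    simp only [RCLike.inner_apply, mul_comm]
  filter_upwards [this] with x hx
  simpa using hx

theorem smoothCompactlySupportedIn_tensor_mem_raySchwartz {f g : ℝ → ℂ}
    (hf : f ∈ smoothCompactlySupportedIn (Ioi 0)) (hg : g ∈ smoothCompactlySupportedIn (Ioi 0)) :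
    (fun q : ℝ × ℝ => f q.1 * g q.2) ∈ raySchwartz := by
  have hf' := hf.1.continuous
  have hg' := hg.1.continuous
  refine ⟨by fun_prop, fun t ht s => ?_, fun a _ => ?_, ?_⟩
  · simp [eq_zero_of_mem_smoothCompactlySupportedIn hf (notMem_Ioi.2 ht)]
  · exact ⟨(hf.2.1.mul_right (f' := fun t => g (a * t))).toSchwartzMap
      (hf.1.mul (hg.1.comp (by fun_prop))), rfl⟩
  · refine (memLp_weightedIoi continuousOn_id hf).tensor (memLp_weightedIoi ?_ hg)
    exact (continuousOn_pow 2).inv₀ fun x hx => pow_ne_zero 2 (ne_of_gt hx)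

theorem dilationFourier_comp_div {f g : ℝ → ℂ} (hf : f ∈ smoothCompactlySupportedIn (Ioi 0))
    (b a : ℝ) :
    dilationFourier (fun q => f q.1 * g (q.2 / q.1)) (b, a) = 𝓕 f b * g a := by
  have h : (fun t => f t * g (a * t / t)) = fun t => g a • f t := by
    ext t
    rcases eq_or_ne t 0 with rfl | ht
    · simp [eq_zero_of_mem_smoothCompactlySupportedIn hf self_notMem_Ioi]
    · rw [mul_div_cancel_right₀ a ht, smul_eq_mul, mul_comm]
  rw [dilationFourier, h, Real.fourier_real_eq_integral_exp_smul,
    Real.fourier_real_eq_integral_exp_smul, ← integral_mul_const]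
  simp only [smul_eq_mul]
  congr! 2 with t
  ring

theorem memLp_fourier_tensor {s : Set ℝ} {φ g : ℝ → ℂ} (hφ : φ ∈ smoothCompactlySupportedIn s)
    (hg : g ∈ smoothCompactlySupportedIn (Ioi 0)) :
    MemLp (fun p : ℝ × ℝ => 𝓕 φ p.1 * g p.2) 2 muG := by
  rw [muG_eq_prod_s10]
  refine (memLp_fourier hφ).tensor (memLp_weightedIoi ?_ hg)
  exact (continuousOn_pow 2).inv₀ fun x hx => pow_ne_zero 2 (ne_of_gt hx)

theorem comp_div_mem_raySchwartz {f g : ℝ → ℂ}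
    (hf : f ∈ smoothCompactlySupportedIn (Ioi 0)) (hg : g ∈ smoothCompactlySupportedIn (Ioi 0)) :
    (fun q : ℝ × ℝ => f q.1 * g (q.2 / q.1)) ∈ raySchwartz := by
  have hf' := hf.1.continuous.measurable
  have hg' := hg.1.continuous.measurable
  have hm : Measurable fun q : ℝ × ℝ => f q.1 * g (q.2 / q.1) := by fun_prop
  have h0 : ∀ t ≤ 0, ∀ s, f t * g (s / t) = 0 := fun t ht s => by
    simp [eq_zero_of_mem_smoothCompactlySupportedIn hf (notMem_Ioi.2 ht)]
  have hS : ∀ a > 0, ∃ φ : 𝓢(ℝ, ℂ), ⇑φ = fun t => f t * g (a * t / t) := fun a _ => by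
    refine ⟨g a • hf.2.1.toSchwartzMap hf.1, ?_⟩
    ext t
    rcases eq_or_ne t 0 with rfl | ht
    · simp [eq_zero_of_mem_smoothCompactlySupportedIn hf self_notMem_Ioi]
    · simp [mul_div_cancel_right₀ a ht, mul_comm]
  refine ⟨hm, h0, hS, ?_⟩
  rw [memLp_two_iff_lintegral_lt_top hm.aestronglyMeasurable, ← lintegral_dilationFourier hm h0 hS]
  have := memLp_fourier_tensor hf hg
  refine lt_of_eq_of_lt (lintegral_congr fun p => ?_)
    ((memLp_two_iff_lintegral_lt_top this.1).1 this)
  rw [← dilationFourier_comp_div hf p.1 p.2]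

theorem memLp_dilationFourier {L : ℝ × ℝ → ℂ} (hL : L ∈ raySchwartz) :
    MemLp (dilationFourier L) 2 muG := by
  rw [memLp_two_iff_lintegral_lt_top (stronglyMeasurable_dilationFourier hL.1).aestronglyMeasurable,
    lintegral_dilationFourier hL.1 hL.2.1 hL.2.2.1]
  exact (memLp_two_iff_lintegral_lt_top hL.2.2.2.1).1 hL.2.2.2

theorem ae_muG_snd_pos : ∀ᵐ p ∂muG, 0 < p.2 := by
  rw [muG_eq_prod_s10]
  exact Measure.quasiMeasurePreserving_snd.ae (ae_weightedIoi_pos _)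

/-- Pairing of `dilationFourier L` with a fixed square-integrable function. -/
noncomputable def dilationPairing {F : ℝ × ℝ → ℂ} (hF : MemLp F 2 muG) : raySchwartz →ₗ[ℂ] ℂ where
  toFun L := ∫ p, F p * dilationFourier L p ∂muG
  map_add' L M := by
    rw [← integral_add (hF.integrable_mul_two (memLp_dilationFourier L.2))
      (hF.integrable_mul_two (memLp_dilationFourier M.2))]
    refine integral_congr_ae ?_
    filter_upwards [ae_muG_snd_pos] with p hp
    obtain ⟨φ, hφ⟩ := L.2.2.2.1 p.2 hp
    obtain ⟨ψ, hψ⟩ := M.2.2.2.1 p.2 hp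
    have h : (fun t => (L + M : raySchwartz).1 (t, p.2 * t)) = ⇑(φ + ψ) := by
      ext t
      simp [hφ, hψ]
    simp only [dilationFourier]
    rw [h, ← hφ, ← hψ, ← mul_add, ← SchwartzMap.fourier_coe, ← SchwartzMap.fourier_coe,
      ← SchwartzMap.fourier_coe, FourierTransform.fourier_add]
    rfl
  map_smul' c L := by
    rw [RingHom.id_apply, smul_eq_mul, ← integral_const_mul]
    refine integral_congr_ae ?_
    filter_upwards [ae_muG_snd_pos] with p hp
    obtain ⟨φ, hφ⟩ := L.2.2.2.1 p.2 hp
    have h : (fun t => (c • L : raySchwartz).1 (t, p.2 * t)) = ⇑(c • φ) := by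
      ext t
      simp [hφ]
    simp only [dilationFourier]
    rw [h, ← hφ, mul_left_comm, ← SchwartzMap.fourier_coe, ← SchwartzMap.fourier_coe,
      FourierTransform.fourier_smul]
    rfl

/-- The class in `L²(dilationMeasure)` of an element of `raySchwartz`. -/
noncomputable def raySchwartzToLp : raySchwartz →ₗ[ℂ] Lp ℂ 2 dilationMeasure where
  toFun L := L.2.2.2.2.toLp L
  map_add' _ _ := rfl
  map_smul' _ _ := rfl

theorem norm_sq_dilationPairing_le {F : ℝ × ℝ → ℂ} (hF : MemLp F 2 muG) (L : raySchwartz) :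
    ‖dilationPairing hF L‖ ^ 2 ≤ (∫⁻ p, ‖F p‖ₑ ^ 2 ∂muG).toReal * ‖raySchwartzToLp L‖ ^ 2 := by
  have hL := L.2
  have hFt := (memLp_two_iff_lintegral_lt_top hF.1).1 hF
  have h := enorm_integral_mul_sq_le hF.1 (memLp_dilationFourier L.2).1
  rw [lintegral_dilationFourier hL.1 hL.2.1 hL.2.2.1] at h
  have hnorm : ‖raySchwartzToLp L‖ₑ ^ 2 = ∫⁻ q, ‖L.1 q‖ₑ ^ 2 ∂dilationMeasure := by
    have := eLpNorm_nnreal_pow_eq_lintegral (μ := dilationMeasure) (f := L.1) (p := 2) two_ne_zero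
    simp only [NNReal.coe_ofNat, ENNReal.rpow_ofNat, ENNReal.coe_ofNat] at this
    rw [← this, ← Lp.enorm_toLp hL.2.2.2]
    rfl
  rw [← hnorm] at h
  have := ENNReal.toReal_mono (ENNReal.mul_ne_top hFt.ne (ENNReal.pow_ne_top enorm_ne_top)) h
  change ‖∫ p, F p * dilationFourier L.1 p ∂muG‖ ^ 2 ≤ _
  simpa using this

theorem integral_mul_dilationFourier_eq_zero {F : ℝ × ℝ → ℂ} (hF : MemLp F 2 muG)
    (h : ∀ f ∈ smoothCompactlySupportedIn (Ioi 0), ∀ g ∈ smoothCompactlySupportedIn (Ioi 0),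
      ∫ p, F p * dilationFourier (fun q => f q.1 * g q.2) p ∂muG = 0)
    {L : ℝ × ℝ → ℂ} (hL : L ∈ raySchwartz) : ∫ p, F p * dilationFourier L p ∂muG = 0 := by
  set S : Set raySchwartz := {M | ∃ f ∈ smoothCompactlySupportedIn (Ioi 0),
    ∃ g ∈ smoothCompactlySupportedIn (Ioi 0), M.1 = fun q => f q.1 * g q.2}
  have hwc : ContinuousOn (fun s : ℝ => (s ^ 2)⁻¹) (Ioi 0) :=
    (continuousOn_pow 2).inv₀ fun x hx => pow_ne_zero 2 (ne_of_gt hx)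
  have hdense : Dense (Submodule.span ℂ (raySchwartzToLp '' S) : Set (Lp ℂ 2 dilationMeasure)) := by
    refine dense_span_of_forall_integral_mul_eq_zero fun G hG hG0 => ?_
    refine (separatesLTwo_weightedIoi measurable_id continuousOn_id fun _ => id).tensor
      (separatesLTwo_weightedIoi (by fun_prop) hwc fun x hx => by positivity)
      (fun f hf => memLp_weightedIoi continuousOn_id hf) (fun g hg => memLp_weightedIoi hwc hg)
      G hG ?_
    rintro _ ⟨f, hf, g, hg, rfl⟩
    have hmem := smoothCompactlySupportedIn_tensor_mem_raySchwartz hf hg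
    rw [← hG0 _ (mem_image_of_mem _ (show ⟨_, hmem⟩ ∈ S from ⟨f, hf, g, hg, rfl⟩))]
    refine integral_congr_ae ?_
    filter_upwards [hmem.2.2.2.coeFn_toLp] with q hq
    exact congrArg (G q * ·) hq.symm
  rw [← Submodule.map_span] at hdense
  have hS : ∀ M ∈ Submodule.span ℂ S, dilationPairing hF M = 0 := by
    have : Submodule.span ℂ S ≤ LinearMap.ker (dilationPairing hF) := by
      refine Submodule.span_le.2 ?_
      rintro ⟨M, hM⟩ ⟨f, hf, g, hg, rfl⟩
      exact h f hf g hg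
    exact this
  set A := (∫⁻ p, ‖F p‖ₑ ^ 2 ∂muG).toReal
  have hclosed : IsClosed {y : Lp ℂ 2 dilationMeasure |
      ‖dilationPairing hF ⟨L, hL⟩‖ ^ 2 ≤ A * ‖raySchwartzToLp ⟨L, hL⟩ - y‖ ^ 2} :=
    isClosed_le continuous_const (by fun_prop)
  have hle := closure_minimal (s := ↑(Submodule.map raySchwartzToLp (Submodule.span ℂ S))) (by
    rintro _ ⟨M, hM, rfl⟩
    have := norm_sq_dilationPairing_le hF (⟨L, hL⟩ - M)
    rwa [map_sub, map_sub, hS M hM, sub_zero] at this) hclosed (hdense (raySchwartzToLp ⟨L, hL⟩))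
  have h0 : ‖dilationPairing hF ⟨L, hL⟩‖ ^ 2 ≤ 0 := by simpa using hle
  exact norm_eq_zero.1 (pow_eq_zero_iff two_ne_zero |>.1 (h0.antisymm (sq_nonneg _)))

theorem ccZero_of_mem_smoothCompactlySupportedIn {f : ℝ → ℂ}
    (hf : f ∈ smoothCompactlySupportedIn (Ioi 0)) : CcZero f :=
  ⟨hf.1.continuous, hf.2⟩

theorem ccZero_mul_conj {f : ℝ → ℂ} (hf : f ∈ smoothCompactlySupportedIn (Ioi 0)) :
    CcZero fun t => t * starRingEnd ℂ (f t) := by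
  have hc := hf.1.continuous
  refine ⟨by fun_prop, ?_, ?_⟩
  · exact (hf.2.1.comp_left (g := starRingEnd ℂ) (map_zero _)).mul_left
  · have hsub : Function.support (fun t : ℝ => (t : ℂ) * starRingEnd ℂ (f t)) ⊆
        Function.support f := fun t ht h => ht (by simp [h])
    exact (closure_mono hsub).trans hf.2.2

theorem coeffP_mul_conj {f g : ℝ → ℂ} (hf : f ∈ smoothCompactlySupportedIn (Ioi 0)) (b a : ℝ) :
    coeffP g (fun t => t * starRingEnd ℂ (f t)) b a =
      dilationFourier (fun q => f q.1 * g q.2) (b, a) := by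
  rw [coeffP, dilationFourier, Real.fourier_real_eq_integral_exp_smul]
  refine Eq.trans ?_ (setIntegral_eq_integral_of_forall_compl_eq_zero (s := Ioi (0 : ℝ)) ?_)
  · refine setIntegral_congr_fun measurableSet_Ioi fun t ht => ?_
    have ht' : (t : ℂ) ≠ 0 := Complex.ofReal_ne_zero.2 (mem_Ioi.1 ht).ne'
    have he : ((-(2 * Real.pi * b * t : ℝ)) * Complex.I : ℂ) =
        ((-2 * Real.pi * t * b : ℝ) : ℂ) * Complex.I := by
      push_cast
      ring
    simp only [he, map_mul, Complex.conj_ofReal, Complex.conj_conj, smul_eq_mul]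
    field_simp
  · intro t ht
    simp [eq_zero_of_mem_smoothCompactlySupportedIn hf ht]

theorem coeffM_eq_coeffP_neg (ξ η : ℝ → ℂ) (b a : ℝ) : coeffM ξ η b a = coeffP ξ η (-b) a := by
  simp [coeffM, coeffP]

theorem integral_mul_fourier_tensor_eq_zero {F : ℝ × ℝ → ℂ} (hF : MemLp F 2 muG)
    (h : ∀ f ∈ smoothCompactlySupportedIn (Ioi 0), ∀ g ∈ smoothCompactlySupportedIn (Ioi 0),
      ∫ p, F p * dilationFourier (fun q => f q.1 * g q.2) p ∂muG = 0)
    {φ g : ℝ → ℂ} (hφ : φ ∈ smoothCompactlySupportedIn (Ioi 0))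
    (hg : g ∈ smoothCompactlySupportedIn (Ioi 0)) :
    ∫ p, F p * (𝓕 φ p.1 * g p.2) ∂muG = 0 := by
  simpa only [dilationFourier_comp_div hφ] using
    integral_mul_dilationFourier_eq_zero hF h (comp_div_mem_raySchwartz hφ hg)

/-- The reflection `(b, a) ↦ (-b, a)`. -/
noncomputable def negFst : ℝ × ℝ ≃ᵐ ℝ × ℝ :=
  (MeasurableEquiv.neg ℝ).prodCongr (MeasurableEquiv.refl ℝ)

theorem measurePreserving_negFst : MeasurePreserving negFst muG muG := by
  rw [muG_eq_prod_s10]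
  exact (Measure.measurePreserving_neg volume).prod (MeasurePreserving.id _)

theorem comp_neg_mem_smoothCompactlySupportedIn {φ : ℝ → ℂ}
    (hφ : φ ∈ smoothCompactlySupportedIn (Iio 0)) :
    (fun x => φ (-x)) ∈ smoothCompactlySupportedIn (Ioi 0) := by
  refine ⟨hφ.1.comp contDiff_neg, hφ.2.1.comp_homeomorph (Homeomorph.neg ℝ), fun x hx => ?_⟩
  have := tsupport_comp_subset_preimage φ (continuous_neg (G := ℝ)) hx
  exact neg_lt_zero.1 (mem_Iio.1 (hφ.2.2 this))

/-- **Density of coefficient functions in `L²(G)`** (Step 1 in the appendix of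
Choi–Ghandehari): the linear span of the coefficient functions
`{ξ *₊ η : ξ, η ∈ C_c((0,∞))} ∪ {ξ *₋ η : ξ, η ∈ C_c((0,∞))}` is dense in
`L²(ℝ × (0,∞), a⁻² db da)`. -/
theorem coefficient_functions_dense_in_L2 :
    Dense ((Submodule.span ℂ
      {F : Lp ℂ 2 muG | ∃ ξ η : ℝ → ℂ, CcZero ξ ∧ CcZero η ∧
        ((⇑F =ᵐ[muG] fun p : ℝ × ℝ => coeffP ξ η p.1 p.2) ∨
         (⇑F =ᵐ[muG] fun p : ℝ × ℝ => coeffM ξ η p.1 p.2))} :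
        Submodule ℂ (Lp ℂ 2 muG)) : Set (Lp ℂ 2 muG)) := by
  refine dense_span_of_forall_integral_mul_eq_zero fun F hF h => ?_
  have hwc : ContinuousOn (fun s : ℝ => (s ^ 2)⁻¹) (Ioi 0) :=
    (continuousOn_pow 2).inv₀ fun x hx => pow_ne_zero 2 (ne_of_gt hx)
  have hneg := measurePreserving_negFst
  have hP : ∀ f ∈ smoothCompactlySupportedIn (Ioi 0), ∀ g ∈ smoothCompactlySupportedIn (Ioi 0),
      ∫ p, F p * dilationFourier (fun q => f q.1 * g q.2) p ∂muG = 0 := by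
    intro f hf g hg
    have hmem := memLp_dilationFourier (smoothCompactlySupportedIn_tensor_mem_raySchwartz hf hg)
    rw [← h (hmem.toLp _) ⟨g, _, ccZero_of_mem_smoothCompactlySupportedIn hg, ccZero_mul_conj hf,
      Or.inl (hmem.coeFn_toLp.trans (ae_of_all _ fun p => (coeffP_mul_conj hf p.1 p.2).symm))⟩]
    refine integral_congr_ae ?_
    filter_upwards [hmem.coeFn_toLp] with p hp
    rw [hp]
  have hM : ∀ f ∈ smoothCompactlySupportedIn (Ioi 0), ∀ g ∈ smoothCompactlySupportedIn (Ioi 0),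
      ∫ p, F (negFst p) * dilationFourier (fun q => f q.1 * g q.2) p ∂muG = 0 := by
    intro f hf g hg
    have hmem := (memLp_dilationFourier
      (smoothCompactlySupportedIn_tensor_mem_raySchwartz hf hg)).comp_measurePreserving hneg
    rw [← h (hmem.toLp _) ⟨g, _, ccZero_of_mem_smoothCompactlySupportedIn hg, ccZero_mul_conj hf,
      Or.inr (hmem.coeFn_toLp.trans (ae_of_all _ fun p =>
        ((coeffM_eq_coeffP_neg _ _ _ _).trans (coeffP_mul_conj hf _ _)).symm))⟩]
    refine Eq.trans ?_ (hneg.integral_comp' _)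
    refine integral_congr_ae ?_
    filter_upwards [hneg.quasiMeasurePreserving.ae hmem.coeFn_toLp] with p hp
    have hpp : negFst (negFst p) = p := Prod.ext (neg_neg p.1) rfl
    rw [hp, Function.comp_apply, hpp]
  have hsep : SeparatesLTwo muG {k | ∃ f ∈ fourierTestFunctions,
      ∃ g ∈ smoothCompactlySupportedIn (Ioi 0), k = fun p => f p.1 * g p.2} := by
    rw [muG_eq_prod_s10]
    refine separatesLTwo_fourierTestFunctions.tensor
      (separatesLTwo_weightedIoi (by fun_prop) hwc fun x hx => by positivity) ?_
      fun g hg => memLp_weightedIoi hwc hg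
    rintro _ ⟨φ, hφ | hφ, rfl⟩
    exacts [memLp_fourier hφ, memLp_fourier hφ]
  refine hsep F hF ?_
  rintro _ ⟨_, ⟨φ, hφ | hφ, rfl⟩, g, hg, rfl⟩
  · exact integral_mul_fourier_tensor_eq_zero hF hP hφ hg
  · have h0 := integral_mul_fourier_tensor_eq_zero (hF.comp_measurePreserving hneg) hM
      (comp_neg_mem_smoothCompactlySupportedIn hφ) hg
    rw [← h0, ← hneg.integral_comp']
    refine integral_congr_ae (ae_of_all _ fun p => ?_)
    have hfourier : 𝓕 (fun x => φ (-x)) p.1 = 𝓕 φ (-p.1) := by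
      rw [← Real.fourierInv_eq_fourier_neg, Real.fourierInv_eq_fourier_comp_neg]
    simp only [hfourier]
    rfl
end

section
/- Let n and m be nonzero integers with n ≠ m, and let ξ₁, η₁, ξ₂, η₂ ∈ C_c^∞(ℝ). Then ∫_ℝ ∫_ℝ ∫₀¹ (ξ₁ *ₙ η₁)(p,q,θ) · conj((ξ₂ *ₘ η₂)(p,q,θ)) dθ dq dp = 0, the integrand being integrable. -/
open MeasureTheory Set

/-- Coefficient function of the `n`-th Schrödinger representation of the
reduced Heisenberg group:
`(ξ *ₙ η)(p,q,θ) = ∫_ℝ e^{2πi n q(−x + p/2)} e^{2πi n θ} ξ(−p + x) conj(η(x)) dx`. -/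
noncomputable def schCoeff (n : ℤ) (ξ η : ℝ → ℂ) (p q θ : ℝ) : ℂ :=
  ∫ x : ℝ,
    Complex.exp ((2 * Real.pi * (n : ℝ) * q * (-x + p / 2) : ℝ) * Complex.I)
      * Complex.exp ((2 * Real.pi * (n : ℝ) * θ : ℝ) * Complex.I)
      * ξ (-p + x) * starRingEnd ℂ (η x)

/-- `C_c^∞(ℝ)`: smooth, compactly supported, complex-valued functions on `ℝ`. -/
def CcInf (f : ℝ → ℂ) : Prop :=
  ContDiff ℝ (⊤ : ℕ∞) f ∧ HasCompactSupport f

/-- Haar measure `dp dq dθ` of the reduced Heisenberg group, modelled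
measure-theoretically on `ℝ × ℝ × [0,1)`. -/
noncomputable def muH : Measure (ℝ × ℝ × ℝ) :=
  (volume : Measure ℝ).prod
    ((volume : Measure ℝ).prod ((volume : Measure ℝ).restrict (Ico (0 : ℝ) 1)))

open scoped FourierTransform Pointwise

lemma schCoeff_eq_fourier (n : ℤ) (ξ η : ℝ → ℂ) (p q θ : ℝ) :
    schCoeff n ξ η p q θ =
      Complex.exp ((Real.pi * n * q * p : ℝ) * Complex.I)
        * Complex.exp ((2 * Real.pi * n * θ : ℝ) * Complex.I)
        * 𝓕 (fun x => ξ (-p + x) * starRingEnd ℂ (η x)) (n * q) := by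
  rw [Real.fourier_real_eq_integral_exp_smul, ← integral_const_mul]
  refine integral_congr_ae (.of_forall fun x => ?_)
  have h : ((2 * Real.pi * (n : ℝ) * q * (-x + p / 2) : ℝ) : ℂ) * Complex.I =
      ((Real.pi * n * q * p : ℝ) : ℂ) * Complex.I
        + ((-2 * Real.pi * x * (n * q) : ℝ) : ℂ) * Complex.I := by
    push_cast; ring
  simp only [h, Complex.exp_add, smul_eq_mul]
  ring

lemma norm_schCoeff (n : ℤ) (ξ η : ℝ → ℂ) (p q θ : ℝ) :
    ‖schCoeff n ξ η p q θ‖ = ‖𝓕 (fun x => ξ (-p + x) * starRingEnd ℂ (η x)) (n * q)‖ := by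
  rw [schCoeff_eq_fourier, norm_mul, norm_mul, Complex.norm_exp_ofReal_mul_I,
    Complex.norm_exp_ofReal_mul_I, one_mul, one_mul]

lemma schCoeff_eq_exp_mul (n : ℤ) (ξ η : ℝ → ℂ) (p q θ : ℝ) :
    schCoeff n ξ η p q θ =
      schCoeff n ξ η p q 0 * Complex.exp ((2 * Real.pi * n * θ : ℝ) * Complex.I) := by
  simp only [schCoeff_eq_fourier]
  simp
  ring

lemma stronglyMeasurable_schCoeff (n : ℤ) {ξ η : ℝ → ℂ} (hξ : Continuous ξ) (hη : Continuous η) :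
    StronglyMeasurable fun x : ℝ × ℝ × ℝ => schCoeff n ξ η x.1 x.2.1 x.2.2 := by
  unfold schCoeff
  refine StronglyMeasurable.integral_prod_right' (f := fun z : (ℝ × ℝ × ℝ) × ℝ =>
    Complex.exp ((2 * Real.pi * (n : ℝ) * z.1.2.1 * (-z.2 + z.1.1 / 2) : ℝ) * Complex.I)
      * Complex.exp ((2 * Real.pi * (n : ℝ) * z.1.2.2 : ℝ) * Complex.I)
      * ξ (-z.1.1 + z.2) * starRingEnd ℂ (η z.2)) (Continuous.stronglyMeasurable ?_)
  have := Complex.continuous_conj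
  fun_prop

lemma schCoeff_eq_zero (n : ℤ) {ξ η : ℝ → ℂ} {p : ℝ} (hp : p ∉ tsupport η - tsupport ξ)
    (q θ : ℝ) : schCoeff n ξ η p q θ = 0 := by
  refine integral_eq_zero_of_ae (.of_forall fun x => ?_)
  by_contra h
  simp only [Pi.zero_apply, mul_eq_zero, not_or, map_eq_zero] at h
  exact hp ⟨x, subset_tsupport _ h.2, -p + x, subset_tsupport _ h.1.2, by ring⟩

lemma norm_fourier_le_integral_norm (f : ℝ → ℂ) (w : ℝ) : ‖𝓕 f w‖ ≤ ∫ x, ‖f x‖ :=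
  VectorFourier.norm_fourierIntegral_le_integral_norm _ _ _ f w

lemma exists_integral_norm_shift_mul_le {f g : ℝ → ℂ} (hf : Continuous f)
    (hf' : HasCompactSupport f) (hg : Continuous g) (hg' : HasCompactSupport g) :
    ∃ C, ∀ p : ℝ, ∫ x, ‖f (-p + x) * g x‖ ≤ C := by
  obtain ⟨M, hM⟩ := hf'.exists_bound_of_continuous hf
  refine ⟨∫ x, M * ‖g x‖, fun p => integral_mono_of_nonneg (.of_forall fun x => norm_nonneg _)
    ((hg.integrable_of_hasCompactSupport hg').norm.const_mul M) (.of_forall fun x => ?_)⟩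
  simp only [norm_mul]
  gcongr
  exact hM _

/-- One integration by parts bounds coefficient functions by a multiple of `1 / (1 + |q|)`,
uniformly in `p` and `θ`. -/
lemma exists_norm_schCoeff_le {n : ℤ} (hn : n ≠ 0) {ξ η : ℝ → ℂ} (hξ : CcInf ξ) (hη : CcInf η) :
    ∃ C, ∀ p q θ, ‖schCoeff n ξ η p q θ‖ ≤ C ∧ |q| * ‖schCoeff n ξ η p q θ‖ ≤ C := by
  set η' : ℝ → ℂ := fun x => starRingEnd ℂ (η x)
  have hsm : ContDiff ℝ (⊤ : ℕ∞) η' := Complex.conjCLE.contDiff.comp hη.1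
  have hcs : HasCompactSupport η' := hη.2.comp_left (g := starRingEnd ℂ) (map_zero _)
  have one_le : (1 : WithTop ℕ∞) ≤ ((⊤ : ℕ∞) : WithTop ℕ∞) := by exact_mod_cast le_top
  have top_ne : ((⊤ : ℕ∞) : WithTop ℕ∞) ≠ 0 := by simp
  have cξ := hξ.1.continuous
  have cη := hsm.continuous
  have cξ' := hξ.1.continuous_deriv one_le
  have cη' := hsm.continuous_deriv one_le
  have dξ := hξ.1.differentiable top_ne
  have dη := hsm.differentiable top_ne
  obtain ⟨A, hA⟩ := exists_integral_norm_shift_mul_le cξ hξ.2 cη hcs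
  obtain ⟨B, hB⟩ := exists_integral_norm_shift_mul_le cξ' hξ.2.deriv cη hcs
  obtain ⟨D, hD⟩ := exists_integral_norm_shift_mul_le cξ hξ.2 cη' hcs.deriv
  refine ⟨max A (B + D), fun p q θ => ?_⟩
  rw [norm_schCoeff]
  set g : ℝ → ℂ := fun x => ξ (-p + x) * η' x
  refine ⟨(norm_fourier_le_integral_norm g _).trans ((hA p).trans (le_max_left _ _)),
    le_trans ?_ (le_max_right _ _)⟩
  have i₀ : Integrable g :=
    (show Continuous g by fun_prop).integrable_of_hasCompactSupport hcs.mul_left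
  have i₁ : Integrable fun x => deriv ξ (-p + x) * η' x :=
    (show Continuous fun x => deriv ξ (-p + x) * η' x by
      fun_prop).integrable_of_hasCompactSupport hcs.mul_left
  have i₂ : Integrable fun x => ξ (-p + x) * deriv η' x :=
    (show Continuous fun x => ξ (-p + x) * deriv η' x by
      fun_prop).integrable_of_hasCompactSupport hcs.deriv.mul_left
  have hd : ∀ x, HasDerivAt g (deriv ξ (-p + x) * η' x + ξ (-p + x) * deriv η' x) x := fun x =>
    ((dξ (-p + x)).hasDerivAt.comp_const_add (-p) x).mul (dη x).hasDerivAt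
  have hdg : deriv g = fun x => deriv ξ (-p + x) * η' x + ξ (-p + x) * deriv η' x :=
    funext fun x => (hd x).deriv
  have key := congrFun (Real.fourier_deriv i₀ (fun x => (hd x).differentiableAt)
    (hdg ▸ i₁.add i₂)) (n * q)
  have hle : ‖𝓕 (deriv g) (n * q)‖ ≤ B + D := by
    refine (norm_fourier_le_integral_norm _ _).trans ?_
    rw [hdg]
    refine (integral_mono (i₁.add i₂).norm (i₁.norm.add i₂.norm) fun x => norm_add_le _ _).trans ?_
    exact (integral_add i₁.norm i₂.norm).le.trans (add_le_add (hB p) (hD p))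
  rw [key, norm_smul] at hle
  refine le_trans ?_ hle
  gcongr
  have h1 : (1 : ℝ) ≤ |(n : ℝ)| := by exact_mod_cast Int.one_le_abs hn
  have h2 : ‖2 * (Real.pi : ℂ) * Complex.I * ((n * q : ℝ) : ℂ)‖
      = 2 * Real.pi * (|(n : ℝ)| * |q|) := by
    simp [abs_of_pos Real.pi_pos]
  rw [h2]
  nlinarith [Real.pi_gt_three, mul_le_mul_of_nonneg_right h1 (abs_nonneg q), abs_nonneg q]

lemma integrable_schCoeff_mul_conj {n m : ℤ} (hn : n ≠ 0) (hm : m ≠ 0) {ξ₁ η₁ ξ₂ η₂ : ℝ → ℂ}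
    (hξ₁ : CcInf ξ₁) (hη₁ : CcInf η₁) (hξ₂ : CcInf ξ₂) (hη₂ : CcInf η₂) :
    Integrable (fun x : ℝ × ℝ × ℝ =>
      schCoeff n ξ₁ η₁ x.1 x.2.1 x.2.2
        * starRingEnd ℂ (schCoeff m ξ₂ η₂ x.1 x.2.1 x.2.2)) muH := by
  obtain ⟨C, hC⟩ := exists_norm_schCoeff_le hn hξ₁ hη₁
  obtain ⟨D, hD⟩ := exists_norm_schCoeff_le hm hξ₂ hη₂
  have hK : IsCompact (tsupport η₁ - tsupport ξ₁) := by
    rw [← Set.sub_image_prod]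
    exact (hη₁.2.isCompact.prod hξ₁.2.isCompact).image continuous_sub
  set K := tsupport η₁ - tsupport ξ₁
  have hdom : Integrable (fun x : ℝ × ℝ × ℝ =>
      K.indicator (fun _ => 2 * (C * D)) x.1 * ((1 + x.2.1 ^ 2)⁻¹ * (1 : ℝ))) muH := by
    have iK : Integrable (K.indicator fun _ => 2 * (C * D)) :=
      (integrable_indicator_iff hK.measurableSet).2 (integrableOn_const hK.measure_lt_top.ne)
    exact iK.mul_prod (integrable_inv_one_add_sq.mul_prod (integrable_const (1 : ℝ)))
  refine hdom.mono' (((stronglyMeasurable_schCoeff n hξ₁.1.continuous hη₁.1.continuous).mul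
    (Complex.continuous_conj.comp_stronglyMeasurable
      (stronglyMeasurable_schCoeff m hξ₂.1.continuous hη₂.1.continuous))).aestronglyMeasurable)
    (.of_forall ?_)
  rintro ⟨p, q, θ⟩
  by_cases hp : p ∈ K
  · obtain ⟨a₁, a₂⟩ := hC p q θ
    obtain ⟨b₁, b₂⟩ := hD p q θ
    simp only [Set.indicator_of_mem hp, norm_mul, RCLike.norm_conj, mul_one]
    rw [← div_eq_mul_inv, le_div_iff₀ (by positivity)]
    have h₁ := mul_le_mul a₁ b₁ (norm_nonneg _) ((norm_nonneg _).trans a₁)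
    have h₂ := mul_le_mul a₂ b₂ (by positivity) ((norm_nonneg _).trans a₁)
    rw [← sq_abs q]
    linarith
  · simp [Set.indicator_of_notMem hp, schCoeff_eq_zero n hp]

lemma integral_Ico_exp_two_pi_mul_int {k : ℤ} (hk : k ≠ 0) :
    ∫ θ in Ico (0 : ℝ) 1, Complex.exp ((2 * Real.pi * k * θ : ℝ) * Complex.I) = 0 := by
  rw [integral_Ico_eq_integral_Ioc, ← intervalIntegral.integral_of_le zero_le_one]
  have hc : 2 * (Real.pi : ℂ) * k * Complex.I ≠ 0 := by
    simp [Real.pi_ne_zero, hk, Complex.I_ne_zero]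
  have h : ∀ θ : ℝ, ((2 * Real.pi * k * θ : ℝ) : ℂ) * Complex.I
      = 2 * (Real.pi : ℂ) * k * Complex.I * θ := fun θ => by push_cast; ring
  simp only [h]
  rw [integral_exp_mul_complex hc]
  have h1 : Complex.exp (2 * (Real.pi : ℂ) * k * Complex.I) = 1 :=
    Complex.exp_eq_one_iff.2 ⟨k, by ring⟩
  simp [h1]

lemma schCoeff_mul_conj_eq (n m : ℤ) (ξ₁ η₁ ξ₂ η₂ : ℝ → ℂ) (p q θ : ℝ) :
    schCoeff n ξ₁ η₁ p q θ * starRingEnd ℂ (schCoeff m ξ₂ η₂ p q θ) =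
      schCoeff n ξ₁ η₁ p q 0 * starRingEnd ℂ (schCoeff m ξ₂ η₂ p q 0)
        * Complex.exp ((2 * Real.pi * (n - m : ℤ) * θ : ℝ) * Complex.I) := by
  have h : ((2 * Real.pi * (n - m : ℤ) * θ : ℝ) : ℂ) * Complex.I
      = ((2 * Real.pi * n * θ : ℝ) : ℂ) * Complex.I
        + -(((2 * Real.pi * m * θ : ℝ) : ℂ) * Complex.I) := by
    push_cast; ring
  rw [schCoeff_eq_exp_mul n, schCoeff_eq_exp_mul m, h, Complex.exp_add, map_mul,
    ← Complex.exp_conj, map_mul, Complex.conj_I, Complex.conj_ofReal, mul_neg]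
  ring

lemma integral_schCoeff_mul_conj_eq_zero {n m : ℤ} (hnm : n ≠ m) (ξ₁ η₁ ξ₂ η₂ : ℝ → ℂ) (p : ℝ) :
    ∫ y : ℝ × ℝ, schCoeff n ξ₁ η₁ p y.1 y.2 * starRingEnd ℂ (schCoeff m ξ₂ η₂ p y.1 y.2)
      ∂((volume : Measure ℝ).prod ((volume : Measure ℝ).restrict (Ico (0 : ℝ) 1))) = 0 := by
  have h := integral_prod_mul (μ := (volume : Measure ℝ))
    (ν := (volume : Measure ℝ).restrict (Ico (0 : ℝ) 1))
    (fun q => schCoeff n ξ₁ η₁ p q 0 * starRingEnd ℂ (schCoeff m ξ₂ η₂ p q 0))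
    (fun θ : ℝ => Complex.exp ((2 * Real.pi * (n - m : ℤ) * θ : ℝ) * Complex.I))
  rw [integral_Ico_exp_two_pi_mul_int (sub_ne_zero.2 hnm), mul_zero] at h
  rw [← h]
  congr 1 with y
  exact schCoeff_mul_conj_eq n m ξ₁ η₁ ξ₂ η₂ p y.1 y.2

/-- **Orthogonality relations for distinct Schrödinger representations**
(Proposition 6.4, second identity, of Choi–Ghandehari): for nonzero `n ≠ m`,
`⟨ξ₁ *ₙ η₁, ξ₂ *ₘ η₂⟩_{L²(ℍ_r)} = 0`. -/
theorem schCoeff_orthogonality_distinct (n m : ℤ) (hn : n ≠ 0) (hm : m ≠ 0)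
    (hnm : n ≠ m) (ξ₁ η₁ ξ₂ η₂ : ℝ → ℂ)
    (hξ₁ : CcInf ξ₁) (hη₁ : CcInf η₁) (hξ₂ : CcInf ξ₂) (hη₂ : CcInf η₂) :
    Integrable (fun x : ℝ × ℝ × ℝ =>
      schCoeff n ξ₁ η₁ x.1 x.2.1 x.2.2
        * starRingEnd ℂ (schCoeff m ξ₂ η₂ x.1 x.2.1 x.2.2)) muH ∧
    ∫ x, schCoeff n ξ₁ η₁ x.1 x.2.1 x.2.2
        * starRingEnd ℂ (schCoeff m ξ₂ η₂ x.1 x.2.1 x.2.2) ∂muH = 0 := by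
  have hint := integrable_schCoeff_mul_conj hn hm hξ₁ hη₁ hξ₂ hη₂
  refine ⟨hint, ?_⟩
  unfold muH at hint ⊢
  rw [integral_prod _ hint]
  simp only [integral_schCoeff_mul_conj_eq_zero hnm, integral_zero]
end
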